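/- Let M_K be an n-by-m integer matrix in Hermite normal form generating lattice K, with sublattices K_a generated by the first a columns. For any real r >= 1, the number of choices of the a-th column v_a (consistent with Hermite normal form) such that vol(K_a) <= r * vol(K_{a-1}) is at most vol(K_{a-1}) * V_{i_a - a + 1}(r + sqrt(i_a - a + 1}), where i_a is the pivot row of column a and V_d(s) is the volume of a d-ball of radius s. Moreover, if r < 1 there are no such choices. -/

import Mathlib

open scoped BigOperators

/-- An integer matrix is in (column-style) Hermite normal form with pivot rows `piv`. -/
def IsHNF {n m : ℕ} (M : Matrix (Fin n) (Fin m) ℤ) (piv : Fin m → Fin n) : Prop :=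
  StrictMono piv ∧ (∀ j i, piv j < i → M i j = 0) ∧ (∀ j, 0 < M (piv j) j) ∧
    (∀ j l, j < l → 0 ≤ M (piv j) l ∧ M (piv j) l < M (piv j) j)

/-- Volume of an `l`-dimensional Euclidean ball of radius `s`. -/
noncomputable def ballVol (l : ℕ) (s : ℝ) : ℝ :=
  Real.pi ^ ((l : ℝ) / 2) * s ^ l / Real.Gamma ((l : ℝ) / 2 + 1)

/-- Volume of the lattice generated by the columns of `B`. -/
noncomputable def latVol {d l : ℕ} (B : Matrix (Fin d) (Fin l) ℝ) : ℝ :=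
  Real.sqrt (B.transpose * B).det

open MeasureTheory

theorem exists_int_round_sum {κ V : Type*} [NormedAddCommGroup V] [InnerProductSpace ℝ V]
    (b : κ → V) (hb : ∀ k, ‖b k‖ ≤ 1) (t : κ → ℝ) (s : Finset κ) :
    ∃ z : κ → ℤ, ‖∑ k ∈ s, (t k - z k) • b k‖ ^ 2 ≤ s.card := by
  classical
  induction s using Finset.induction_on with
  | empty => exact ⟨0, by simp⟩
  | insert k s hk ih =>
    obtain ⟨z, hz⟩ := ih
    set y := ∑ j ∈ s, (t j - z j) • b j with hy
    obtain ⟨m, hm⟩ : ∃ m : ℤ, ‖(t k - m) • b k + y‖ ^ 2 ≤ 1 + ‖y‖ ^ 2 := by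
      have key (c : ℝ) (hc : |c| ≤ 1) (hi : c * inner ℝ (b k) y ≤ 0) :
          ‖c • b k + y‖ ^ 2 ≤ 1 + ‖y‖ ^ 2 := by
        rw [norm_add_sq_real, inner_smul_left, norm_smul, Real.norm_eq_abs]
        have h1 : |c| * ‖b k‖ ≤ 1 := mul_le_one₀ hc (norm_nonneg _) (hb k)
        have h2 : 0 ≤ |c| * ‖b k‖ := by positivity
        simp only [conj_trivial]
        nlinarith
      have h0 := Int.fract_nonneg (t k)
      have h1 := Int.fract_lt_one (t k)
      rcases le_total (inner ℝ (b k) y) 0 with h | h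
      · refine ⟨⌊t k⌋, key _ ?_ ?_⟩ <;> rw [Int.self_sub_floor]
        · rw [abs_of_nonneg h0]; exact h1.le
        · exact mul_nonpos_of_nonneg_of_nonpos h0 h
      · have e : t k - ((⌊t k⌋ + 1 : ℤ) : ℝ) = Int.fract (t k) - 1 := by
          rw [← Int.self_sub_floor]; push_cast; ring
        refine ⟨⌊t k⌋ + 1, key _ ?_ ?_⟩ <;> rw [e]
        · rw [abs_le]; constructor <;> linarith
        · exact mul_nonpos_of_nonpos_of_nonneg (by linarith) h
    refine ⟨Function.update z k m, ?_⟩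
    rw [Finset.sum_insert hk, Function.update_self, Finset.card_insert_of_notMem hk]
    have : ∑ j ∈ s, (t j - (Function.update z k m j : ℤ)) • b j = y := by
      refine Finset.sum_congr rfl fun j hj => ?_
      rw [Function.update_of_ne (ne_of_mem_of_not_mem hj hk)]
    rw [this]
    push_cast
    linarith

theorem norm_transpose_mulVec_le {ρ δ : Type*} [Fintype ρ] [Fintype δ] [DecidableEq δ]
    {O : Matrix ρ δ ℝ} (hO : O.transpose * O = 1) (x : ρ → ℝ) :
    ‖WithLp.toLp 2 (O.transpose.mulVec x)‖ ≤ ‖WithLp.toLp 2 x‖ := by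
  set w := O.transpose.mulVec x with hw
  have h : 0 ≤ (x - O.mulVec w) ⬝ᵥ (x - O.mulVec w) := by
    simpa using dotProduct_star_self_nonneg (x - O.mulVec w)
  have h1 : x ⬝ᵥ O.mulVec w = w ⬝ᵥ w := by
    rw [Matrix.dotProduct_mulVec, ← Matrix.mulVec_transpose]
  have h2 : O.mulVec w ⬝ᵥ O.mulVec w = w ⬝ᵥ w := by
    rw [Matrix.dotProduct_mulVec, ← Matrix.mulVec_transpose, Matrix.mulVec_mulVec, hO,
      Matrix.one_mulVec]
  rw [sub_dotProduct, dotProduct_sub, dotProduct_sub, dotProduct_comm (O.mulVec w) x, h1, h2] at h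
  rw [← sq_le_sq₀ (norm_nonneg _) (norm_nonneg _), EuclideanSpace.real_norm_sq_eq,
    EuclideanSpace.real_norm_sq_eq]
  simp only [dotProduct] at h
  simp only [sq]
  linarith

theorem exists_int_near_transpose_mulVec {ρ δ : Type*} [Fintype ρ] [Fintype δ] [DecidableEq δ]
    {O : Matrix ρ δ ℝ} (hO : O.transpose * O = 1) (x : ρ → ℝ) :
    ∃ z : ρ → ℤ, ‖WithLp.toLp 2 (O.transpose.mulVec (x - fun i => (z i : ℝ)))‖ ≤
      Real.sqrt (Fintype.card δ) := by
  classical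
  let f : (ρ → ℝ) →ₗ[ℝ] EuclideanSpace ℝ δ :=
    (WithLp.linearEquiv 2 ℝ (δ → ℝ)).symm.toLinearMap ∘ₗ O.transpose.mulVecLin
  have hf (y) : f y = WithLp.toLp 2 (O.transpose.mulVec y) := rfl
  have hsurj : LinearMap.range f = ⊤ := by
    rw [LinearMap.range_eq_top]
    intro w
    exact ⟨O.mulVec w.ofLp, by rw [hf, Matrix.mulVec_mulVec, hO, Matrix.one_mulVec]⟩
  let v : ρ → EuclideanSpace ℝ δ := fun i => f (Pi.single i 1)
  have hspan : Submodule.span ℝ (Set.range v) = ⊤ := by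
    have h : Set.range v = f '' Set.range (Pi.basisFun ℝ ρ) := by
      rw [← Set.range_comp]; congr 1
    rw [h, Submodule.span_image, (Pi.basisFun ℝ ρ).span_eq, Submodule.map_top, hsurj]
  have hv (i) : ‖v i‖ ≤ 1 := by
    refine (norm_transpose_mulVec_le hO _).trans ?_
    have := PiLp.norm_single 2 (fun _ : ρ => ℝ) i (1 : ℝ)
    rw [norm_one] at this
    exact this.le
  obtain ⟨κ, a, ha, hs, hli⟩ := exists_linearIndependent' ℝ v
  have : Fintype κ := Fintype.ofInjective a ha
  rw [hspan] at hs
  have hcard : Fintype.card κ = Fintype.card δ := by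
    have := finrank_span_eq_card hli
    rw [hs, finrank_top, finrank_euclideanSpace] at this
    exact this.symm
  obtain ⟨t, ht⟩ := (Submodule.mem_span_range_iff_exists_fun ℝ).1
    (show f x ∈ Submodule.span ℝ (Set.range (v ∘ a)) by rw [hs]; trivial)
  obtain ⟨z, hz⟩ := exists_int_round_sum (v ∘ a) (fun k => hv _) t Finset.univ
  refine ⟨∑ k, Pi.single (a k) (z k), ?_⟩
  have e : (fun i => (((∑ k, Pi.single (a k) (z k) : ρ → ℤ) i : ℤ) : ℝ)) =
      ∑ k, (z k : ℝ) • (Pi.single (a k) 1 : ρ → ℝ) := by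
    ext i
    simp only [Finset.sum_apply, Int.cast_sum, Pi.smul_apply, smul_eq_mul]
    refine Finset.sum_congr rfl fun k _ => ?_
    by_cases h : i = a k
    · subst h; simp
    · simp [h]
  rw [← hf, e, map_sub, ← ht]
  have e' : ∑ i, t i • (v ∘ a) i - f (∑ k, (z k : ℝ) • (Pi.single (a k) 1 : ρ → ℝ)) =
      ∑ k, (t k - z k) • (v ∘ a) k := by
    simp only [map_sum, map_smul, sub_smul, Finset.sum_sub_distrib]
    rfl
  rw [e']
  apply Real.le_sqrt_of_sq_le
  rw [← hcard, ← Finset.card_univ]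
  exact hz

theorem le_volume_of_forall_exists_translates {ρ : Type*} [Fintype ρ] {T : Set (ρ → ℝ)}
    (hT : MeasurableSet T) (k : ℕ)
    (h : ∀ x : ρ → ℝ, ∃ F : Finset (ρ → ℤ), F.card = k ∧
      ∀ z ∈ F, (x + fun i => (z i : ℝ)) ∈ T) : (k : ENNReal) ≤ volume T := by
  classical
  let b := Pi.basisFun ℝ ρ
  let G := (Submodule.span ℤ (Set.range b)).toAddSubgroup
  let D := ZSpan.fundamentalDomain b
  have hD := ZSpan.isAddFundamentalDomain' b volume
  have hvD : volume D = 1 := by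
    simp only [D, b, ZSpan.fundamentalDomain_pi_basisFun, volume_pi_pi]
    simp
  have hG (z : ρ → ℤ) : (fun i => (z i : ℝ)) ∈ G := by
    change _ ∈ Submodule.span ℤ (Set.range b)
    rw [(Pi.basisFun ℝ ρ).mem_span_iff_repr_mem ℤ]
    intro i; exact ⟨z i, by simp⟩
  let g : (ρ → ℤ) → G := fun z => -⟨_, hG z⟩
  have hg : Function.Injective g := by
    intro z w hzw
    have := congrArg Subtype.val (neg_injective hzw)
    ext i
    exact Int.cast_injective (α := ℝ) (congrFun this i)
  have : Countable (Submodule.span ℤ (Set.range b)).toAddSubgroup :=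
    inferInstanceAs (Countable (Submodule.span ℤ (Set.range b)))
  have h1 := hD.lintegral_eq_tsum' (T.indicator 1)
  rw [lintegral_indicator_one hT, ← lintegral_tsum] at h1
  · rw [h1]
    calc (k : ENNReal) = ∫⁻ x in D, (k : ENNReal) := by simp [hvD]
      _ ≤ _ := by
        refine lintegral_mono fun x => ?_
        obtain ⟨F, hF, hx⟩ := h x
        refine le_trans ?_ (ENNReal.sum_le_tsum (F.map ⟨g, hg⟩))
        rw [Finset.sum_map, ← hF, Finset.card_eq_sum_ones, Nat.cast_sum]
        refine Finset.sum_le_sum fun z hz => ?_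
        have : -(g z) +ᵥ x = x + fun i => (z i : ℝ) := by
          simp only [g, neg_neg, AddSubgroup.vadd_def, vadd_eq_add, add_comm]
        simp [this, hx z hz]
  · intro z
    refine Measurable.aemeasurable ?_
    exact (measurable_one.indicator hT).comp (measurable_const_vadd (-z))

theorem volume_setOf_norm_toLp_le {d : ℕ} (hd : 0 < d) {s : ℝ} (hs : 0 ≤ s) :
    volume {w : Fin d → ℝ | ‖WithLp.toLp 2 w‖ ≤ s} = ENNReal.ofReal
      (Real.pi ^ ((d : ℝ) / 2) * s ^ d / Real.Gamma ((d : ℝ) / 2 + 1)) := by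
  have : Nonempty (Fin d) := ⟨⟨0, hd⟩⟩
  have h := (PiLp.volume_preserving_toLp (Fin d)).measure_preimage
    (measurableSet_closedBall (x := (0 : EuclideanSpace ℝ (Fin d))) (ε := s)).nullMeasurableSet
  rw [EuclideanSpace.volume_closedBall, Fintype.card_fin] at h
  have e : {w : Fin d → ℝ | ‖WithLp.toLp 2 w‖ ≤ s} =
      WithLp.toLp 2 ⁻¹' Metric.closedBall (0 : EuclideanSpace ℝ (Fin d)) s := by
    ext w; simp
  rw [e, h, ← ENNReal.ofReal_pow hs, ← ENNReal.ofReal_mul (by positivity)]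
  congr 1
  have : Real.sqrt Real.pi ^ d = Real.pi ^ ((d : ℝ) / 2) := by
    rw [Real.sqrt_eq_rpow, ← Real.rpow_natCast, ← Real.rpow_mul Real.pi_pos.le]
    congr 1; ring
  rw [this]
  ring

theorem volume_preimage_mulVec {ρ μ : Type*} [Fintype ρ] [Fintype μ] [DecidableEq ρ]
    [DecidableEq μ] (e : μ ≃ ρ) {M : Matrix ρ μ ℝ} {H : Matrix μ ρ ℝ} (hHM : H * M = 1)
    (S : Set (μ → ℝ)) (hS : MeasurableSet S) :
    volume (H.mulVec ⁻¹' S) = ENNReal.ofReal (Real.sqrt (M.transpose * M).det) * volume S := by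
  let M' : Matrix μ μ ℝ := M.submatrix e id
  let H' : Matrix μ μ ℝ := H.submatrix id e
  have h1 : H' * M' = 1 := by
    rw [← hHM]; exact Matrix.submatrix_mul_equiv H M id e id
  have hdet : H'.det * M'.det = 1 := by rw [← Matrix.det_mul, h1, Matrix.det_one]
  have h2 : M'.transpose * M' = M.transpose * M :=
    Matrix.submatrix_mul_equiv M.transpose M id e id
  have h3 : Real.sqrt (M.transpose * M).det = |M'.det| := by
    rw [← h2, Matrix.det_mul, Matrix.det_transpose, Real.sqrt_mul_self_eq_abs]
  have hne : LinearMap.det (Matrix.toLin' H') ≠ 0 := by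
    rw [LinearMap.det_toLin']; exact left_ne_zero_of_mul_eq_one hdet
  have hp := volume_measurePreserving_piCongrLeft (fun _ : ρ => ℝ) e
  have hmeas : Measurable H.mulVec :=
    (Continuous.matrix_mulVec continuous_const continuous_id).measurable
  rw [← hp.measure_preimage (hmeas hS).nullMeasurableSet, h3]
  have h4 : (MeasurableEquiv.piCongrLeft (fun _ : ρ => ℝ) e) ⁻¹' (H.mulVec ⁻¹' S) =
      Matrix.toLin' H' ⁻¹' S := by
    rw [← Set.preimage_comp]
    congr 1
    ext x j
    simp only [Function.comp, Matrix.toLin'_apply, Matrix.mulVec, dotProduct, H',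
      Matrix.submatrix_apply, id]
    rw [← e.sum_comp]
    refine Finset.sum_congr rfl fun i _ => ?_
    rw [MeasurableEquiv.coe_piCongrLeft, Equiv.piCongrLeft_apply_apply]
  rw [h4, Measure.addHaar_preimage_linearMap _ hne, LinearMap.det_toLin',
    inv_eq_of_mul_eq_one_right hdet]

theorem exists_orthonormal_cols_orthogonal {ρ α : Type*} [Fintype ρ] [Fintype α] {d : ℕ}
    {A : Matrix ρ α ℝ} (hA : ∀ c, A.mulVec c = 0 → c = 0)
    (hcard : Fintype.card ρ = Fintype.card α + d) :
    ∃ O : Matrix ρ (Fin d) ℝ, O.transpose * O = 1 ∧ A.transpose * O = 0 := by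
  classical
  let c : α → EuclideanSpace ℝ ρ := fun j => WithLp.toLp 2 (A.col j)
  have hc : LinearIndependent ℝ c := by
    rw [Fintype.linearIndependent_iff]
    intro g hg j
    refine congrFun (hA g ?_) j
    ext i
    have := congrArg (fun y : EuclideanSpace ℝ ρ => y i) hg
    simpa [c, Matrix.mulVec, dotProduct, mul_comm] using this
  let W := (Submodule.span ℝ (Set.range c))ᗮ
  have hW : Module.finrank ℝ W = d := by
    have h := (Submodule.span ℝ (Set.range c)).finrank_add_finrank_orthogonal
    rw [finrank_span_eq_card hc, finrank_euclideanSpace, hcard] at h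
    exact Nat.add_left_cancel h
  let o := (stdOrthonormalBasis ℝ W).reindex (finCongr hW)
  refine ⟨Matrix.of fun i k => (o k : EuclideanSpace ℝ ρ) i, ?_, ?_⟩
  · ext k l
    have h := orthonormal_iff_ite.1 o.orthonormal l k
    rw [Submodule.coe_inner, EuclideanSpace.inner_eq_star_dotProduct] at h
    rw [Matrix.one_apply, Matrix.mul_apply]
    simp only [@eq_comm _ k l]
    rw [← h]
    rfl
  · ext j k
    have h := (Submodule.mem_orthogonal _ _).1 (o k).2 (c j) (Submodule.subset_span ⟨j, rfl⟩)
    rw [EuclideanSpace.inner_eq_star_dotProduct, dotProduct_comm] at h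
    exact h

theorem isUnit_det_transpose_mul_self {ρ α : Type*} [Fintype ρ] [Fintype α] [DecidableEq α]
    {A : Matrix ρ α ℝ} (hA : ∀ c, A.mulVec c = 0 → c = 0) : IsUnit (A.transpose * A).det := by
  rw [← Matrix.isUnit_iff_isUnit_det, ← Matrix.mulVec_injective_iff_isUnit,
    ← Matrix.coe_mulVecLin, ← LinearMap.ker_eq_bot, Matrix.ker_mulVecLin_transpose_mul_self,
    LinearMap.ker_eq_bot']
  exact hA

section OrthogonalComplement

variable {ρ α : Type*} [Fintype ρ] [Fintype α] [DecidableEq α] {d : ℕ}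
  {A : Matrix ρ α ℝ} {O : Matrix ρ (Fin d) ℝ}

theorem fromRows_mul_fromCols_eq_one (hA : ∀ c, A.mulVec c = 0 → c = 0)
    (hO : O.transpose * O = 1) (hAO : A.transpose * O = 0) :
    Matrix.fromRows ((A.transpose * A)⁻¹ * A.transpose) O.transpose * Matrix.fromCols A O = 1 := by
  have hOA : O.transpose * A = 0 := by
    rw [← Matrix.transpose_inj, Matrix.transpose_mul]; simpa using hAO
  rw [Matrix.fromRows_mul_fromCols, Matrix.mul_assoc, Matrix.mul_assoc, hAO, hOA, hO,
    Matrix.nonsing_inv_mul _ (isUnit_det_transpose_mul_self hA), Matrix.mul_zero,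
    Matrix.fromBlocks_one]

variable [DecidableEq ρ]

theorem add_mul_transpose_eq_one (hA : ∀ c, A.mulVec c = 0 → c = 0)
    (hO : O.transpose * O = 1) (hAO : A.transpose * O = 0)
    (hcard : Fintype.card ρ = Fintype.card α + d) :
    A * ((A.transpose * A)⁻¹ * A.transpose) + O * O.transpose = 1 := by
  rw [← Matrix.fromCols_mul_fromRows]
  exact (Matrix.mul_eq_one_comm_of_card_eq _ _ _ (by simp [hcard])).1
    (fromRows_mul_fromCols_eq_one hA hO hAO)

theorem one_le_norm_transpose_mulVec (hA : ∀ c, A.mulVec c = 0 → c = 0)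
    (hO : O.transpose * O = 1) (hAO : A.transpose * O = 0)
    (hcard : Fintype.card ρ = Fintype.card α + d) {i : ρ} (hi : ∀ j, A i j = 0) {v : ρ → ℝ}
    (hv : 1 ≤ v i) : 1 ≤ ‖WithLp.toLp 2 (O.transpose.mulVec v)‖ := by
  set e : ρ → ℝ := Pi.single i 1 with he
  have h1 : O.mulVec (O.transpose.mulVec e) = e := by
    have h := congrArg (fun X => X.mulVec e) (add_mul_transpose_eq_one hA hO hAO hcard)
    have h0 : A.transpose.mulVec e = 0 := by
      ext j; simp [he, hi]
    simpa [Matrix.add_mulVec, ← Matrix.mulVec_mulVec, h0] using h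
  have h2 : inner ℝ (WithLp.toLp 2 (O.transpose.mulVec e)) (WithLp.toLp 2 (O.transpose.mulVec v)) =
      v i := by
    rw [EuclideanSpace.inner_eq_star_dotProduct, star_trivial, Matrix.mulVec_transpose O v,
      ← Matrix.dotProduct_mulVec, h1]
    simp [he]
  have h3 : ‖WithLp.toLp 2 (O.transpose.mulVec e)‖ ≤ 1 := by
    refine (norm_transpose_mulVec_le hO _).trans ?_
    have := PiLp.norm_single 2 (fun _ : ρ => ℝ) i (1 : ℝ)
    rw [norm_one] at this
    exact this.le
  have h4 := real_inner_le_norm (WithLp.toLp 2 (O.transpose.mulVec e))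
    (WithLp.toLp 2 (O.transpose.mulVec v))
  rw [h2] at h4
  exact hv.trans (h4.trans (mul_le_of_le_one_left (norm_nonneg _) h3))

theorem sqrt_det_gram_fromCols_single (hA : ∀ c, A.mulVec c = 0 → c = 0)
    (hO : O.transpose * O = 1) (hAO : A.transpose * O = 0)
    (hcard : Fintype.card ρ = Fintype.card α + d) (v : ρ → ℝ) :
    Real.sqrt ((Matrix.fromCols A (Matrix.replicateCol (Fin 1) v)).transpose *
        Matrix.fromCols A (Matrix.replicateCol (Fin 1) v)).det =
      Real.sqrt (A.transpose * A).det * ‖WithLp.toLp 2 (O.transpose.mulVec v)‖ := by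
  have hu := isUnit_det_transpose_mul_self hA
  let _ := Matrix.invertibleOfIsUnitDet _ hu
  set C : Matrix ρ (Fin 1) ℝ := Matrix.replicateCol (Fin 1) v
  rw [Matrix.transpose_fromCols, Matrix.fromRows_mul_fromCols, Matrix.det_fromBlocks₁₁,
    Matrix.invOf_eq_nonsing_inv]
  have h : C.transpose * C - C.transpose * A * (A.transpose * A)⁻¹ * (A.transpose * C) =
      (O.transpose * C).transpose * (O.transpose * C) := by
    have h := add_mul_transpose_eq_one hA hO hAO hcard
    rw [Matrix.transpose_mul, Matrix.transpose_transpose, sub_eq_iff_eq_add]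
    calc C.transpose * C = C.transpose * ((1 : Matrix ρ ρ ℝ) * C) := by rw [Matrix.one_mul]
      _ = _ := by
        rw [← h]; simp only [Matrix.add_mul, Matrix.mul_add, Matrix.mul_assoc]; rw [add_comm]
  have hdet : ((O.transpose * C).transpose * (O.transpose * C)).det =
      ‖WithLp.toLp 2 (O.transpose.mulVec v)‖ ^ 2 := by
    rw [EuclideanSpace.real_norm_sq_eq, Matrix.det_fin_one, Matrix.mul_apply]
    refine Finset.sum_congr rfl fun k _ => ?_
    rw [sq]; rfl
  have hnn : 0 ≤ (A.transpose * A).det := by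
    have := (Matrix.posSemidef_conjTranspose_mul_self A).det_nonneg
    simpa using this
  rw [h, hdet, Real.sqrt_mul hnn, Real.sqrt_sq (norm_nonneg _)]

theorem card_le_sqrt_det_mul_ball_volume (hd : 0 < d) {B : Matrix ρ α ℤ}
    (hB : B.map (Int.cast : ℤ → ℝ) = A) (hA : ∀ c, A.mulVec c = 0 → c = 0)
    (hO : O.transpose * O = 1) (hAO : A.transpose * O = 0)
    (hcard : Fintype.card ρ = Fintype.card α + d) {r : ℝ} (hr : 0 ≤ r) (S : Finset (ρ → ℤ))
    (hS : ∀ v ∈ S, ‖WithLp.toLp 2 (O.transpose.mulVec fun i => (v i : ℝ))‖ ≤ r)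
    (hmod : ∀ v ∈ S, ∀ w ∈ S, ∀ c : α → ℤ, v = w + B.mulVec c → v = w) :
    (S.card : ℝ) ≤ Real.sqrt (A.transpose * A).det *
      (Real.pi ^ ((d : ℝ) / 2) * (r + Real.sqrt d) ^ d / Real.Gamma ((d : ℝ) / 2 + 1)) := by
  set G := (A.transpose * A)⁻¹ * A.transpose with hG
  set H := Matrix.fromRows G O.transpose with hH
  have hHM : H * Matrix.fromCols A O = 1 := fromRows_mul_fromCols_eq_one hA hO hAO
  have hGA : G * A = 1 := by
    rw [hG, Matrix.mul_assoc, Matrix.nonsing_inv_mul _ (isUnit_det_transpose_mul_self hA)]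
  have hOA : O.transpose * A = 0 := by
    rw [← Matrix.transpose_inj, Matrix.transpose_mul]; simpa using hAO
  set s := r + Real.sqrt d with hs
  have hs0 : 0 ≤ s := by positivity
  let P : Set ((α → ℝ) × (Fin d → ℝ)) :=
    (Set.univ.pi fun _ => Set.Ico 0 1) ×ˢ {w | ‖WithLp.toLp 2 w‖ ≤ s}
  have hP : MeasurableSet P := by
    refine (MeasurableSet.univ_pi fun _ => measurableSet_Ico).prod ?_
    refine measurableSet_le ?_ measurable_const
    exact (PiLp.continuous_toLp 2 _).norm.measurable
  have hmp := volume_measurePreserving_sumPiEquivProdPi (fun _ : α ⊕ Fin d => ℝ)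
  let Q := MeasurableEquiv.sumPiEquivProdPi (fun _ : α ⊕ Fin d => ℝ) ⁻¹' P
  have hQ : MeasurableSet Q := hmp.measurable hP
  have e : α ⊕ Fin d ≃ ρ := (Fintype.card_eq.1 (by simp [hcard])).some
  have hvol := volume_preimage_mulVec e hHM Q hQ
  have hgram : ((Matrix.fromCols A O).transpose * Matrix.fromCols A O).det =
      (A.transpose * A).det := by
    rw [Matrix.transpose_fromCols, Matrix.fromRows_mul_fromCols, hOA, hAO, hO,
      Matrix.det_fromBlocks_zero₂₁, Matrix.det_one, mul_one]
  have hvQ : volume Q = ENNReal.ofReal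
      (Real.pi ^ ((d : ℝ) / 2) * s ^ d / Real.Gamma ((d : ℝ) / 2 + 1)) := by
    rw [hmp.measure_preimage hP.nullMeasurableSet, Measure.volume_eq_prod, Measure.prod_prod,
      volume_setOf_norm_toLp_le hd hs0, volume_pi_pi]
    simp
  rw [hgram, hvQ, ← ENNReal.ofReal_mul (Real.sqrt_nonneg _)] at hvol
  have hT : MeasurableSet (H.mulVec ⁻¹' Q) :=
    (Continuous.matrix_mulVec continuous_const continuous_id).measurable hQ
  have hle := le_volume_of_forall_exists_translates hT S.card ?_
  · rw [hvol, ← ENNReal.ofReal_natCast] at hle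
    refine (ENNReal.ofReal_le_ofReal_iff (mul_nonneg (Real.sqrt_nonneg _) ?_)).1 hle
    have : 0 < Real.Gamma ((d : ℝ) / 2 + 1) := Real.Gamma_pos_of_pos (by positivity)
    positivity
  intro x
  obtain ⟨z, hz⟩ := exists_int_near_transpose_mulVec hO x
  rw [Fintype.card_fin] at hz
  set x' := x - fun i => (z i : ℝ) with hx'
  let k : (ρ → ℤ) → α → ℤ := fun v j => ⌊G.mulVec (x' + fun i => (v i : ℝ)) j⌋
  let t : (ρ → ℤ) → ρ → ℤ := fun v => v - z - B.mulVec (k v)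
  have ht : Set.InjOn t S := by
    intro v hv w hw h
    refine hmod v hv w hw (k v - k w) ?_
    have h' : v - z - B.mulVec (k v) = w - z - B.mulVec (k w) := h
    rw [Matrix.mulVec_sub]
    ext i
    have := congrFun h' i
    simp only [Pi.sub_apply, Pi.add_apply] at this ⊢
    linarith
  refine ⟨S.image t, Finset.card_image_of_injOn ht, fun y hy => ?_⟩
  obtain ⟨v, hv, rfl⟩ := Finset.mem_image.1 hy
  have hxt : (x + fun i => ((t v i : ℤ) : ℝ)) =
      x' + (fun i => (v i : ℝ)) - A.mulVec fun j => (k v j : ℝ) := by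
    ext i
    simp only [t, hx', ← hB, Pi.add_apply, Pi.sub_apply, Matrix.mulVec, dotProduct,
      Matrix.map_apply]
    push_cast
    ring
  rw [hxt, Set.mem_preimage, hH, Matrix.fromRows_mulVec]
  refine ⟨fun j _ => ?_, ?_⟩
  · change G.mulVec _ j ∈ Set.Ico (0 : ℝ) 1
    rw [Matrix.mulVec_sub, Matrix.mulVec_mulVec, hGA, Matrix.one_mulVec, Pi.sub_apply,
      Int.self_sub_floor]
    exact ⟨Int.fract_nonneg _, Int.fract_lt_one _⟩
  · change ‖WithLp.toLp 2 (O.transpose.mulVec _)‖ ≤ s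
    rw [Matrix.mulVec_sub, Matrix.mulVec_mulVec, hOA, Matrix.zero_mulVec, sub_zero,
      Matrix.mulVec_add, WithLp.toLp_add, hs, add_comm r]
    exact (norm_add_le _ _).trans (add_le_add hz (hS v hv))

end OrthogonalComplement

theorem transpose_mul_self_submatrix_subtype {ι μ : Type*} [Fintype ι] {p : ι → Prop}
    [DecidablePred p] (X : Matrix ι μ ℝ) (hX : ∀ i, ¬ p i → ∀ j, X i j = 0) :
    (X.submatrix (Subtype.val : {i // p i} → ι) id).transpose *
      X.submatrix (Subtype.val : {i // p i} → ι) id = X.transpose * X := by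
  ext j k
  simp only [Matrix.mul_apply, Matrix.transpose_apply, Matrix.submatrix_apply, id]
  rw [← Finset.sum_subtype (Finset.univ.filter p) (by simp) fun i => X i j * X i k]
  refine Finset.sum_filter_of_ne fun i _ h => ?_
  by_contra hi
  exact h (by rw [hX i hi, zero_mul])

namespace IsHNF

variable {n a : ℕ} {A : Matrix (Fin n) (Fin a) ℤ} {piv : Fin a → Fin n}

theorem exists_mulVec_pivot_eq (hH : IsHNF A piv) {R : Type*} [CommRing R] {c : Fin a → R}
    (hc : c ≠ 0) :
    ∃ j, c j ≠ 0 ∧ (A.map (Int.cast : ℤ → R)).mulVec c (piv j) = (A (piv j) j : R) * c j := by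
  classical
  obtain ⟨j₀, hj₀⟩ := Function.ne_iff.1 hc
  have hne : (Finset.univ.filter fun j => c j ≠ 0).Nonempty := ⟨j₀, by simpa using hj₀⟩
  set j := (Finset.univ.filter fun j => c j ≠ 0).max' hne with hj
  refine ⟨j, (Finset.mem_filter.1 (Finset.max'_mem _ hne)).2, ?_⟩
  rw [Matrix.mulVec, dotProduct, Finset.sum_eq_single j]
  · rfl
  · intro l _ hl
    rcases lt_or_gt_of_ne hl with h | h
    · rw [Matrix.map_apply, hH.2.1 l _ (hH.1 h), Int.cast_zero, zero_mul]
    · have : c l = 0 := by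
        by_contra hcl
        exact absurd (Finset.le_max' _ l (by simpa using hcl)) (not_le.2 h)
      rw [this, mul_zero]
  · simp

theorem eq_of_eq_add_mulVec (hH : IsHNF A piv) {v w : Fin n → ℤ}
    (hv : ∀ j, 0 ≤ v (piv j) ∧ v (piv j) < A (piv j) j)
    (hw : ∀ j, 0 ≤ w (piv j) ∧ w (piv j) < A (piv j) j) {c : Fin a → ℤ}
    (h : ∀ j, v (piv j) = w (piv j) + A.mulVec c (piv j)) : c = 0 := by
  by_contra hc
  obtain ⟨j, hj, hjc⟩ := hH.exists_mulVec_pivot_eq hc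
  have hA : A.map (Int.cast : ℤ → ℤ) = A := by ext; simp
  have h' := h j
  rw [hA, Int.cast_id] at hjc
  rw [hjc] at h'
  have h1 : A (piv j) j * |c j| < A (piv j) j := by
    have : A (piv j) j * |c j| = |v (piv j) - w (piv j)| := by
      rw [h', add_sub_cancel_left, abs_mul, abs_of_pos (hH.2.2.1 j)]
    rw [this, abs_lt]
    constructor <;> linarith [(hv j).1, (hv j).2, (hw j).1, (hw j).2]
  have h2 := Int.one_le_abs hj
  nlinarith [hH.2.2.1 j]

end IsHNF

theorem stmt8 {n a : ℕ} (A : Matrix (Fin n) (Fin a) ℤ) (piv : Fin a → Fin n)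
    (hH : IsHNF A piv) (ia : Fin n) (hia : ∀ j, piv j < ia) (r : ℝ)
    (Chc : Set (Fin n → ℤ))
    (hChc : Chc = {v : Fin n → ℤ | 0 < v ia ∧ (∀ i, ia < i → v i = 0) ∧
      (∀ j, 0 ≤ v (piv j) ∧ v (piv j) < A (piv j) j) ∧
      latVol (Matrix.of fun i (j : Fin (a + 1)) =>
          if h : (j : ℕ) < a then (A i ⟨j, h⟩ : ℝ) else (v i : ℝ)) ≤
        r * latVol (A.map (Int.cast : ℤ → ℝ))}) :
    (1 ≤ r → (Chc.ncard : ℝ) ≤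
      latVol (A.map (Int.cast : ℤ → ℝ)) *
        ballVol ((ia : ℕ) + 1 - a)
          (r + Real.sqrt (((ia : ℕ) + 1 - a : ℕ) : ℝ))) ∧
    (r < 1 → Chc = ∅) := by
  let res : {i : Fin n // i ≤ ia} → Fin n := Subtype.val
  let B : Matrix {i : Fin n // i ≤ ia} (Fin a) ℤ := A.submatrix res id
  let A' : Matrix {i : Fin n // i ≤ ia} (Fin a) ℝ := B.map (Int.cast : ℤ → ℝ)
  have hpiv (j) : piv j ≤ ia := (hia j).le
  have haia : a ≤ ia := by
    have h := Finset.card_le_card_of_injOn piv (s := Finset.univ) (t := Finset.Iio ia)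
      (by intro j _; simpa using hia j) hH.1.injective.injOn
    simpa using h
  set d := (ia : ℕ) + 1 - a with hd
  have hd0 : 0 < d := by omega
  have hcard : Fintype.card {i : Fin n // i ≤ ia} = Fintype.card (Fin a) + d := by
    rw [Fintype.card_fin, Fintype.card_subtype, Finset.filter_ge_eq_Iic, Fin.card_Iic]
    omega
  have hA' : ∀ c, A'.mulVec c = 0 → c = 0 := by
    intro c hc
    by_contra hc0
    obtain ⟨j, hj, hjc⟩ := hH.exists_mulVec_pivot_eq hc0
    have : (A.map (Int.cast : ℤ → ℝ)).mulVec c (piv j) = 0 := congrFun hc ⟨piv j, hpiv j⟩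
    rw [this] at hjc
    have hp : (A (piv j) j : ℝ) ≠ 0 := Int.cast_ne_zero.2 (hH.2.2.1 j).ne'
    exact mul_ne_zero hp hj hjc.symm
  obtain ⟨O, hO, hAO⟩ := exists_orthonormal_cols_orthogonal hA' hcard
  have hAzero (i : Fin n) (hi : ¬ i ≤ ia) (j : Fin a) : A i j = 0 :=
    hH.2.1 j i ((hia j).trans (not_le.1 hi))
  have hvolA : latVol (A.map (Int.cast : ℤ → ℝ)) = Real.sqrt (A'.transpose * A').det := by
    rw [latVol, ← transpose_mul_self_submatrix_subtype (p := fun i => i ≤ ia)]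
    · rfl
    · intro i hi j
      rw [Matrix.map_apply, hAzero i hi j, Int.cast_zero]
  have hvolA_pos : 0 < latVol (A.map (Int.cast : ℤ → ℝ)) := by
    rw [hvolA, Real.sqrt_pos]
    refine lt_of_le_of_ne ?_ (isUnit_det_transpose_mul_self hA').ne_zero.symm
    simpa using (Matrix.posSemidef_conjTranspose_mul_self A').det_nonneg
  have hvol (v : Fin n → ℤ) (hv : ∀ i, ia < i → v i = 0) :
      latVol (Matrix.of fun i (j : Fin (a + 1)) =>
          if h : (j : ℕ) < a then (A i ⟨j, h⟩ : ℝ) else (v i : ℝ)) =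
        latVol (A.map (Int.cast : ℤ → ℝ)) *
          ‖WithLp.toLp 2 (O.transpose.mulVec fun i => (v (res i) : ℝ))‖ := by
    set X : Matrix (Fin n) (Fin (a + 1)) ℝ := Matrix.of fun i j =>
      if h : (j : ℕ) < a then (A i ⟨j, h⟩ : ℝ) else (v i : ℝ)
    have hX : Matrix.fromCols A' (Matrix.replicateCol (Fin 1) fun i => (v (res i) : ℝ)) =
        (X.submatrix res id).submatrix id finSumFinEquiv := by
      ext i j
      rcases j with j | j <;> simp [X, A', B, res]
    rw [hvolA, ← sqrt_det_gram_fromCols_single hA' hO hAO hcard, latVol, hX,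
      ← transpose_mul_self_submatrix_subtype (p := fun i => i ≤ ia),
      ← Matrix.det_submatrix_equiv_self finSumFinEquiv]
    · rfl
    · intro i hi j
      simp only [X, Matrix.of_apply]
      split_ifs
      · rw [hAzero i hi, Int.cast_zero]
      · rw [hv i (not_le.1 hi), Int.cast_zero]
  have hnorm (v) (hv : v ∈ Chc) :
      ‖WithLp.toLp 2 (O.transpose.mulVec fun i => (v (res i) : ℝ))‖ ≤ r := by
    rw [hChc] at hv
    have h := hv.2.2.2
    rw [hvol v hv.2.1, mul_comm r] at h
    exact le_of_mul_le_mul_left h hvolA_pos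
  refine ⟨fun hr => ?_, fun hr => ?_⟩
  · rw [hvolA, ballVol]
    rcases Chc.finite_or_infinite with hfin | hinf
    · have hinj : Set.InjOn (fun (v : Fin n → ℤ) i => v (res i)) Chc := by
        intro v hv w hw h
        rw [hChc] at hv hw
        ext i
        by_cases hi : i ≤ ia
        · exact congrFun h ⟨i, hi⟩
        · rw [hv.2.1 i (not_le.1 hi), hw.2.1 i (not_le.1 hi)]
      have hcardS : (hfin.toFinset.image fun v i => v (res i)).card = Chc.ncard := by
        rw [Finset.card_image_of_injOn (by simpa using hinj), Set.ncard_eq_toFinset_card Chc hfin]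
      rw [← hcardS]
      refine card_le_sqrt_det_mul_ball_volume hd0 (B := B) rfl hA' hO hAO hcard
        (zero_le_one.trans hr) _ ?_ ?_
      · intro v hv
        obtain ⟨v, hv', rfl⟩ := Finset.mem_image.1 hv
        exact hnorm v (hfin.mem_toFinset.1 hv')
      · intro v hv w hw c h
        obtain ⟨v, hv', rfl⟩ := Finset.mem_image.1 hv
        obtain ⟨w, hw', rfl⟩ := Finset.mem_image.1 hw
        rw [hfin.mem_toFinset, hChc] at hv' hw'
        have hc := hH.eq_of_eq_add_mulVec hv'.2.2.1 hw'.2.2.1 (c := c)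
          fun j => congrFun h ⟨piv j, hpiv j⟩
        rw [h, hc, Matrix.mulVec_zero, add_zero]
    · rw [hinf.ncard, Nat.cast_zero]
      have : 0 < Real.Gamma ((d : ℝ) / 2 + 1) := Real.Gamma_pos_of_pos (by positivity)
      positivity
  · rw [Set.eq_empty_iff_forall_notMem]
    intro v hv
    have h1 := hnorm v hv
    rw [hChc] at hv
    have h2 := one_le_norm_transpose_mulVec hA' hO hAO hcard (i := ⟨ia, le_rfl⟩)
      (v := fun i => (v (res i) : ℝ))
      (fun j => by
        change ((A ia j : ℤ) : ℝ) = 0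
        rw [hH.2.1 j ia (hia j), Int.cast_zero])
      (by exact_mod_cast hv.1)
    linarith
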